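/- Let G be a chordal graph on n vertices with perfect elimination order v_1, ..., v_n, and for 1 ≤ m ≤ n let G_m be the subgraph of G induced by v_1, ..., v_m (with G_0 the empty graph). Let S_G be the (n+1)×(n+1) matrix with rows and columns indexed by {0, 1, ..., n} whose (m,k) entry is {G_m brace k}. Then S_G is totally non-negative. -/

import Mathlib

/-- The ordering `0 < 1 < ⋯ < n-1` of the vertices of `G` is a perfect elimination
order: for each vertex `k`, its neighbors among the earlier vertices form a clique.
(A graph is chordal iff it admits a perfect elimination order.) -/
def IsPEO {n : ℕ} (G : SimpleGraph (Fin n)) : Prop :=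
  ∀ k i j : Fin n, i < k → j < k → i ≠ j → G.Adj i k → G.Adj j k → G.Adj i j

/-- The graph Stirling number of the second kind `{G_m brace k}` of the subgraph
`G_m` of `G` induced by the first `m` vertices: the number of partitions of the
vertex set of `G_m` into `k` non-empty independent sets. -/
noncomputable def graphStirlingInduced {n : ℕ} (G : SimpleGraph (Fin n)) (m k : ℕ) : ℕ :=
  Nat.card {P : Finset (Finset (Fin n)) //
    P.card = k ∧
    (∀ B ∈ P, B.Nonempty) ∧
    (∀ B ∈ P, ∀ v ∈ B, (v : ℕ) < m) ∧
    (∀ v : Fin n, (v : ℕ) < m → ∃! B, B ∈ P ∧ v ∈ B) ∧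
    ∀ B ∈ P, ∀ u ∈ B, ∀ w ∈ B, ¬ G.Adj u w}

/-- Total non-negativity of the rows `≤ n` of an infinite matrix. -/
def TNNRows (n : ℕ) (A : ℕ → ℕ → ℝ) : Prop :=
  ∀ (p : ℕ) (r c : Fin p → ℕ), StrictMono r → StrictMono c → (∀ i, r i ≤ n) →
    0 ≤ (Matrix.of fun i j => A (r i) (c j)).det

/-- The operator of the recurrence. -/
def stepD (x : ℕ) (f : ℕ → ℝ) (k : ℕ) : ℝ :=
  (if k = 0 then 0 else f (k - 1)) + ((k : ℝ) - x) * f k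

/-- The triangular array attached to a sequence. -/
def arrT (a : ℕ → ℕ) : ℕ → ℕ → ℝ
  | 0 => fun k => if k = 0 then 1 else 0
  | m + 1 => stepD (a m) (arrT a m)

lemma stepD_comm (x y : ℕ) (f : ℕ → ℝ) : stepD x (stepD y f) = stepD y (stepD x f) := by
  funext k
  rcases k with _ | k
  · simp [stepD]; ring
  · rcases k with _ | k <;> simp [stepD] <;> ring

lemma stepD_shift (x y : ℕ) (f : ℕ → ℝ) (k : ℕ) :
    stepD x f k = stepD y f k + ((y : ℝ) - x) * f k := by
  simp only [stepD]; ring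

lemma arrT_congr {a b : ℕ → ℕ} (m : ℕ) (h : ∀ i < m, a i = b i) : arrT a m = arrT b m := by
  induction m with
  | zero => rfl
  | succ m ih =>
    simp only [arrT]
    rw [ih (fun i hi => h i (by omega)), h m (by omega)]

lemma TNNRows.rowOp {n : ℕ} {A B : ℕ → ℕ → ℝ} (hB : TNNRows n B) (i : ℕ) (c : ℝ) (hc : 0 ≤ c)
    (h1 : ∀ m ≤ n, m ≠ i + 1 → A m = B m)
    (h2 : ∀ k, A (i + 1) k = B (i + 1) k + c * B i k) : TNNRows n A := by
  intro p r s hr hs hn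
  by_cases hex : ∃ q, r q = i + 1
  · obtain ⟨q, hq⟩ := hex
    set M : Matrix (Fin p) (Fin p) ℝ := Matrix.of fun i j => B (r i) (s j) with hM
    have hne : ∀ q', q' ≠ q → r q' ≠ i + 1 := fun q' h h' => h (hr.injective (h'.trans hq.symm))
    have hA : (Matrix.of fun i j => A (r i) (s j)) =
        M.updateRow q (M q + c • fun j => B i (s j)) := by
      ext x y
      by_cases hx : x = q
      · subst hx
        simp [hM, hq, h2]
      · simp [hM, Matrix.updateRow_ne hx, h1 _ (hn x) (hne x hx)]
    rw [hA, Matrix.det_updateRow_add, Matrix.det_updateRow_smul, Matrix.updateRow_eq_self]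
    have e1 : 0 ≤ M.det := hB p r s hr hs hn
    have e2 : 0 ≤ (M.updateRow q fun j => B i (s j)).det := by
      by_cases hex' : ∃ q', r q' = i
      · obtain ⟨q', hq'⟩ := hex'
        have hqq : q' ≠ q := by rintro rfl; omega
        rw [Matrix.det_zero_of_row_eq hqq]
        ext y
        simp [hM, Matrix.updateRow_ne hqq, hq']
      · have := hB p (Function.update r q i) s ?_ hs ?_
        · convert this using 2
          ext x y
          by_cases hx : x = q
          · subst hx; simp
          · simp [hM, Matrix.updateRow_ne hx, Function.update_of_ne hx]
        · intro x y hxy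
          have hlt := hr hxy
          have nx : r x ≠ i := fun h => hex' ⟨_, h⟩
          by_cases hx : x = q
          · subst hx
            rw [Function.update_self, Function.update_of_ne hxy.ne']
            omega
          · by_cases hy : y = q
            · subst hy
              rw [Function.update_self, Function.update_of_ne hx]
              omega
            · rw [Function.update_of_ne hx, Function.update_of_ne hy]
              exact hlt
        · intro x
          by_cases hx : x = q
          · subst hx
            rw [Function.update_self]
            have := hn x
            omega
          · rw [Function.update_of_ne hx]; exact hn x
    have := mul_nonneg hc e2
    linarith
  · have : (Matrix.of fun i j => A (r i) (s j)) = Matrix.of fun i j => B (r i) (s j) := by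
      ext x y
      simp only [Matrix.of_apply]
      rw [h1 _ (hn x) (fun h => hex ⟨_, h⟩)]
    rw [this]
    exact hB p r s hr hs hn

lemma TNNRows.one {n : ℕ} {A : ℕ → ℕ → ℝ}
    (h : ∀ m ≤ n, ∀ k, A m k = if k = m then 1 else 0) : TNNRows n A := by
  intro p r s hr hs hn
  by_cases hrs : r = s
  · subst hrs
    have : (Matrix.of fun i j => A (r i) (r j)) = (1 : Matrix (Fin p) (Fin p) ℝ) := by
      ext x y
      simp only [Matrix.of_apply, h _ (hn x), Matrix.one_apply, hr.injective.eq_iff]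
      simp only [eq_comm]
    rw [this]; simp
  · have : ∃ x, ∀ y, s y ≠ r x := by
      by_contra hcon
      push Not at hcon
      apply hrs
      have hsub : Set.range r ⊆ Set.range s := by
        rintro _ ⟨x, rfl⟩
        exact hcon x
      have heq : Set.range r = Set.range s := by
        apply Set.eq_of_subset_of_ncard_le hsub
        · rw [← Set.image_univ, ← Set.image_univ, Set.ncard_image_of_injective _ hr.injective,
            Set.ncard_image_of_injective _ hs.injective]
      exact (StrictMono.range_inj hr hs).1 heq
    obtain ⟨x, hx⟩ := this
    rw [Matrix.det_eq_zero_of_row_eq_zero x]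
    intro y
    simp [h _ (hn x), hx y]

/-- Restricted growth. -/
def RGrow (n : ℕ) (a : ℕ → ℕ) : Prop :=
  ∀ i < n, a i = 0 ∨ ∃ j < i, a i ≤ a j + 1

lemma arrT_id {n : ℕ} {a : ℕ → ℕ} (h : ∀ i < n, a i = i) (m : ℕ) (hm : m ≤ n) (k : ℕ) :
    arrT a m k = if k = m then 1 else 0 := by
  induction m generalizing k with
  | zero => simp [arrT]
  | succ m ih =>
    simp only [arrT, stepD, h m (by omega)]
    rw [ih (by omega), ih (by omega)]
    rcases k with _ | k
    · by_cases h0 : 0 = m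
      · subst h0; simp
      · simp [h0]
    · by_cases h0 : k + 1 = m
      · subst h0; simp
      · simp [h0]

/-- Swapping the entries at positions `i, i+1`. -/
lemma arrT_swap_tnn {n : ℕ} {a b : ℕ → ℕ} (i : ℕ) (h1 : a i = b (i + 1)) (h2 : a (i + 1) = b i)
    (h3 : ∀ j, j ≠ i → j ≠ i + 1 → a j = b j) (hlt : a i ≤ b i) (hb : TNNRows n (arrT b)) :
    TNNRows n (arrT a) := by
  have low : ∀ m ≤ i, arrT a m = arrT b m := fun m hm =>
    arrT_congr m (fun j hj => h3 j (by omega) (by omega))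
  have high : ∀ t, arrT a (i + 2 + t) = arrT b (i + 2 + t) := by
    intro t
    induction t with
    | zero =>
      show stepD (a (i + 1)) (stepD (a i) (arrT a i)) = stepD (b (i + 1)) (stepD (b i) (arrT b i))
      rw [low i le_rfl, h1, h2, stepD_comm]
    | succ t ih =>
      show stepD (a (i + 2 + t)) (arrT a (i + 2 + t)) = stepD (b (i + 2 + t)) (arrT b (i + 2 + t))
      rw [ih, h3 _ (by omega) (by omega)]
  refine hb.rowOp i ((b i : ℝ) - a i) (sub_nonneg.2 (by exact_mod_cast hlt)) ?_ ?_
  · intro m _ hm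
    rcases Nat.lt_or_ge i m with h | h
    · obtain ⟨t, rfl⟩ := Nat.exists_eq_add_of_le (show i + 2 ≤ m by omega)
      exact high t
    · exact low m h
  · intro k
    show stepD (a i) (arrT a i) k = stepD (b i) (arrT b i) k + _
    rw [low i le_rfl]
    exact stepD_shift _ _ _ _

/-- Increasing the last entry. -/
lemma arrT_last_tnn {n : ℕ} {a b : ℕ → ℕ} (h : ∀ j < n, a j = b j) (hlt : a n ≤ b n)
    (hb : TNNRows (n + 1) (arrT b)) : TNNRows (n + 1) (arrT a) := by
  refine hb.rowOp n ((b n : ℝ) - a n) (sub_nonneg.2 (by exact_mod_cast hlt)) ?_ ?_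
  · intro m hm hm'
    exact arrT_congr m (fun j hj => h j (by omega))
  · intro k
    show stepD (a n) (arrT a n) k = stepD (b n) (arrT b n) k + _
    rw [arrT_congr n h]
    exact stepD_shift _ _ _ _

lemma arrT_inner {n k : ℕ} (hk : 0 < k)
    (H : ∀ a : ℕ → ℕ, RGrow n a → (∀ i < k + 1, i < n → a i = i) → TNNRows n (arrT a)) (t : ℕ) :
    ∀ a : ℕ → ℕ, RGrow n a → (∀ i < k, i < n → a i = i) → k + t < n → a (k + t) = k →
      (∀ i, k ≤ i → i < k + t → a i < k) → TNNRows n (arrT a) := by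
  induction t with
  | zero =>
    intro a ha h1 h2 h3 _
    apply H a ha
    intro i hi hin
    rcases Nat.lt_or_ge i k with h | h
    · exact h1 i h hin
    · obtain rfl : i = k := by omega
      simpa using h3
  | succ t ih =>
    intro a ha h1 h2 h3 h4
    set b : ℕ → ℕ := fun j => if j = k + t then a (k + t + 1) else
      if j = k + t + 1 then a (k + t) else a j with hb
    have b0 : b (k + t) = k := by simp [hb]; exact h3
    have b1 : b (k + t + 1) = a (k + t) := by simp [hb]
    have b2 : ∀ j, j ≠ k + t → j ≠ k + t + 1 → b j = a j := by
      intro j hj hj'; simp [hb, hj, hj']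
    have l := h4 (k + t) (by omega) (by omega)
    have b3 : b (k - 1) = k - 1 := by
      rw [b2 _ (by omega) (by omega), h1 _ (by omega) (by omega)]
    refine arrT_swap_tnn (b := b) (k + t) b1.symm (h3.trans b0.symm)
      (fun j hj hj' => (b2 j hj hj').symm) (by omega) ?_
    apply ih b
    · intro i hi
      by_cases e0 : i = k + t
      · right; refine ⟨k - 1, by omega, ?_⟩; rw [b3, e0, b0]; omega
      by_cases e1 : i = k + t + 1
      · right; refine ⟨k - 1, by omega, ?_⟩; rw [b3, e1, b1]; omega
      rw [b2 i e0 e1]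
      rcases ha i hi with h | ⟨j, hj, h⟩
      · exact Or.inl h
      · right
        by_cases f0 : j = k + t
        · refine ⟨k + t + 1, by omega, ?_⟩; rw [b1, ← f0]; exact h
        by_cases f1 : j = k + t + 1
        · refine ⟨k + t, by omega, ?_⟩
          rw [b0]; rw [f1] at h; rw [show k + t + 1 = k + (t + 1) from rfl, h3] at h; exact h
        exact ⟨j, hj, by rw [b2 j f0 f1]; exact h⟩
    · intro i hi hin
      rw [b2 _ (by omega) (by omega)]; exact h1 i hi hin
    · omega
    · exact b0
    · intro i hi hi'
      rw [b2 _ (by omega) (by omega)]; exact h4 i hi (by omega)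

lemma RGrow.lt {n k : ℕ} {a : ℕ → ℕ} (ha : RGrow n a) (hk : 0 < k) (h : ∀ i < k, i < n → a i = i)
    (N : ℕ) (hN : N ≤ n) (hne : ∀ i, k ≤ i → i < N → a i ≠ k) :
    ∀ i, k ≤ i → i < N → a i < k := by
  intro i
  induction i using Nat.strong_induction_on with
  | _ i ih =>
    intro hi hiN
    have := hne i hi hiN
    rcases ha i (by omega) with h0 | ⟨j, hj, hle⟩
    · omega
    · rcases Nat.lt_or_ge j k with hjk | hjk
      · have := h j hjk (by omega)
        omega
      · have := ih j hj hjk (by omega)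
        omega

lemma arrT_tnn_aux {n : ℕ} (d : ℕ) : ∀ k, 0 < k → n ≤ k + d → ∀ a : ℕ → ℕ, RGrow n a →
    (∀ i < k, i < n → a i = i) → TNNRows n (arrT a) := by
  induction d with
  | zero =>
    intro k _ hk a _ h
    exact TNNRows.one (arrT_id (fun i hi => h i (by omega) hi))
  | succ d ih =>
    intro k hk hn a ha h
    rcases Nat.lt_or_ge k n with hkn | hkn
    swap
    · exact TNNRows.one (arrT_id (fun i hi => h i (by omega) hi))
    have H := ih (k + 1) (by omega) (by omega)
    by_cases hex : ∃ j, k ≤ j ∧ j < n ∧ a j = k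
    · classical
      obtain ⟨hj1, hj2, hj3⟩ := Nat.find_spec hex
      have hmin := fun m (hm : m < Nat.find hex) => Nat.find_min hex hm
      generalize Nat.find hex = j at *
      obtain ⟨t, rfl⟩ := Nat.exists_eq_add_of_le hj1
      refine arrT_inner hk H t a ha h hj2 hj3 ?_
      exact ha.lt hk h (k + t) hj2.le (fun i hi hi' e => hmin i hi' ⟨hi, by omega, e⟩)
    · push Not at hex
      have hl := ha.lt hk h n le_rfl hex
      obtain ⟨n, rfl⟩ : ∃ n', n = n' + 1 := ⟨n - 1, by omega⟩
      obtain ⟨t, rfl⟩ := Nat.exists_eq_add_of_le (show k ≤ n by omega)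
      have c : ∀ j, j ≠ k + t → Function.update a (k + t) k j = a j := fun j hj =>
        Function.update_of_ne hj _ _
      refine arrT_last_tnn (b := Function.update a (k + t) k) (fun j hj => (c j hj.ne).symm) ?_ ?_
      · rw [Function.update_self]; exact (hl _ (by omega) (by omega)).le
      · refine arrT_inner hk H t _ ?_ ?_ (by omega) (Function.update_self _ _ _) ?_
        · intro i hi
          by_cases e : i = k + t
          · right
            refine ⟨k - 1, by omega, ?_⟩
            rw [e, Function.update_self, c _ (by omega), h _ (by omega) (by omega)]; omega
          · rw [c i e]
            rcases ha i hi with h0 | ⟨j, hj, hle⟩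
            · exact Or.inl h0
            · exact Or.inr ⟨j, hj, by rw [c j (by omega)]; exact hle⟩
        · intro i hi hin
          rw [c _ (by omega)]; exact h i hi hin
        · intro i hi hi'
          rw [c _ (by omega)]; exact hl i hi (by omega)

lemma arrT_tnn {n : ℕ} (a : ℕ → ℕ) (ha : RGrow n a) : TNNRows n (arrT a) := by
  refine arrT_tnn_aux n 1 one_pos (by omega) a ha ?_
  intro i hi hin
  rcases ha i hin with h | ⟨j, hj, _⟩ <;> omega

/-! ### The combinatorial recurrence -/

section Comb
variable {n : ℕ} (G : SimpleGraph (Fin n))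

/-- Partition of the first `m` vertices into `k` independent sets. -/
def IsPart (m k : ℕ) (P : Finset (Finset (Fin n))) : Prop :=
    P.card = k ∧
    (∀ B ∈ P, B.Nonempty) ∧
    (∀ B ∈ P, ∀ v ∈ B, (v : ℕ) < m) ∧
    (∀ v : Fin n, (v : ℕ) < m → ∃! B, B ∈ P ∧ v ∈ B) ∧
    ∀ B ∈ P, ∀ u ∈ B, ∀ w ∈ B, ¬ G.Adj u w

open Classical in
/-- The finset of such partitions. -/
noncomputable def partSet (m k : ℕ) : Finset (Finset (Finset (Fin n))) :=
  Finset.univ.filter (IsPart G m k)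

lemma mem_partSet {m k : ℕ} {P : Finset (Finset (Fin n))} :
    P ∈ partSet G m k ↔ IsPart G m k P := by simp [partSet]

lemma gsi_eq (m k : ℕ) : graphStirlingInduced G m k = (partSet G m k).card := by
  classical
  unfold graphStirlingInduced partSet
  rw [Nat.card_eq_fintype_card, Fintype.card_subtype]
  congr 1
  ext P
  simp only [Finset.mem_filter, IsPart]

open Classical in
/-- The number of earlier neighbours. -/
noncomputable def backDeg (m : ℕ) : ℕ :=
  (Finset.univ.filter fun u : Fin n => (u : ℕ) < m ∧ ∃ h : m < n, G.Adj u ⟨m, h⟩).card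

lemma backDeg_rgrow (hG : IsPEO G) : RGrow n (backDeg G) := by
  classical
  intro m hm
  set N := Finset.univ.filter fun u : Fin n => (u : ℕ) < m ∧ ∃ h : m < n, G.Adj u ⟨m, h⟩ with hN
  rcases N.eq_empty_or_nonempty with h | h
  · left
    unfold backDeg
    rw [Finset.card_eq_zero, ← h, hN]
  · right
    have hu := N.max'_mem h
    have hmax : ∀ x ∈ N, x ≤ N.max' h := fun x hx => N.le_max' x hx
    generalize N.max' h = u at *
    simp only [hN, Finset.mem_filter, Finset.mem_univ, true_and] at hu
    obtain ⟨hum, _, hadj⟩ := hu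
    refine ⟨u, hum, ?_⟩
    have : N.erase u ⊆
        Finset.univ.filter fun w : Fin n => (w : ℕ) < u ∧ ∃ h : (u : ℕ) < n, G.Adj w ⟨u, h⟩ := by
      intro w hw
      rw [Finset.mem_erase] at hw
      have h1 := hmax w hw.2
      have h2 : w < u := lt_of_le_of_ne h1 hw.1
      have h3 := hw.2
      simp only [hN, Finset.mem_filter, Finset.mem_univ, true_and] at h3 ⊢
      obtain ⟨hwm, _, hadj'⟩ := h3
      exact ⟨h2, u.2, hG ⟨m, hm⟩ w u hwm hum hw.1 hadj' hadj⟩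
    have hc := Finset.card_le_card this
    have hc' := Finset.pred_card_le_card_erase (s := N) (a := u)
    have e1 : backDeg G m = N.card := rfl
    unfold backDeg at e1 ⊢
    omega

open Classical in
lemma card_good (hG : IsPEO G) {m k : ℕ} (hm : m < n) {Q : Finset (Finset (Fin n))}
    (hQ : IsPart G m k Q) :
    (Q.filter fun B => ∀ u ∈ B, ¬ G.Adj u ⟨m, hm⟩).card + backDeg G m = k := by
  obtain ⟨hc, hne, hlt, hex, hind⟩ := hQ
  rw [← hc, ← Finset.card_filter_add_card_filter_not (s := Q)
    (fun B => ∀ u ∈ B, ¬ G.Adj u ⟨m, hm⟩)]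
  congr 1
  unfold backDeg
  choose! b hb using fun v hv => (hex v hv).exists
  have hu : ∀ v : Fin n, (v : ℕ) < m → ∀ B ∈ Q, v ∈ B → B = b v := fun v hv B hB hvB =>
    (hex v hv).unique ⟨hB, hvB⟩ (hb v hv)
  refine Finset.card_bij (fun u _ => b u) ?_ ?_ ?_
  · intro u hu'
    simp only [Finset.mem_filter, Finset.mem_univ, true_and] at hu' ⊢
    obtain ⟨h1, _, h2⟩ := hu'
    refine ⟨(hb u h1).1, fun h => h u (hb u h1).2 h2⟩
  · intro u h1 w h2 he
    simp only [Finset.mem_filter, Finset.mem_univ, true_and] at h1 h2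
    obtain ⟨h1, _, h1'⟩ := h1
    obtain ⟨h2, _, h2'⟩ := h2
    by_contra hne
    refine hind (b u) (hb u h1).1 u (hb u h1).2 w ?_ (hG ⟨m, hm⟩ u w h1 h2 hne h1' h2')
    rw [he]; exact (hb w h2).2
  · intro B hB
    simp only [Finset.mem_filter] at hB
    obtain ⟨hB, h⟩ := hB
    push Not at h
    obtain ⟨u, huB, hadj⟩ := h
    have := hlt B hB u huB
    refine ⟨u, ?_, (hu u this B hB huB).symm⟩
    simp only [Finset.mem_filter, Finset.mem_univ, true_and]
    exact ⟨this, hm, hadj⟩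

open Classical in
lemma card_single {m k : ℕ} (hm : m < n) :
    ((partSet G (m + 1) (k + 1)).filter fun P => {⟨m, hm⟩} ∈ P).card = (partSet G m k).card := by
  set v : Fin n := ⟨m, hm⟩ with hv
  have hvm : (v : ℕ) = m := rfl
  refine Finset.card_bij' (fun P _ => P.erase {v}) (fun Q _ => insert {v} Q) ?_ ?_ ?_ ?_
  · intro P hP
    rw [Finset.mem_filter, mem_partSet] at hP
    obtain ⟨⟨hc, hne, hlt, hex, hind⟩, hvP⟩ := hP
    rw [mem_partSet]
    refine ⟨?_, ?_, ?_, ?_, ?_⟩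
    · rw [Finset.card_erase_of_mem hvP]; omega
    · intro B hB; exact hne B (Finset.mem_of_mem_erase hB)
    · intro B hB u hu
      rw [Finset.mem_erase] at hB
      have h1 := hlt B hB.2 u hu
      rcases Nat.lt_or_ge u m with h | h
      · exact h
      · exfalso
        have : u = v := Fin.ext (by omega)
        subst this
        exact hB.1 ((hex v (by omega)).unique ⟨hB.2, hu⟩ ⟨hvP, by simp⟩)
    · intro u hu
      obtain ⟨B, ⟨hB, huB⟩, hun⟩ := hex u (by omega)
      refine ⟨B, ⟨Finset.mem_erase.2 ⟨?_, hB⟩, huB⟩, ?_⟩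
      · rintro rfl
        rw [Finset.mem_singleton] at huB
        subst huB; omega
      · intro C hC
        exact hun C ⟨Finset.mem_of_mem_erase hC.1, hC.2⟩
    · intro B hB; exact hind B (Finset.mem_of_mem_erase hB)
  · intro Q hQ
    rw [mem_partSet] at hQ
    obtain ⟨hc, hne, hlt, hex, hind⟩ := hQ
    rw [Finset.mem_filter, mem_partSet]
    have hvQ : ∀ B ∈ Q, v ∉ B := fun B hB h => by have := hlt B hB v h; omega
    refine ⟨⟨?_, ?_, ?_, ?_, ?_⟩, Finset.mem_insert_self _ _⟩
    · rw [Finset.card_insert_of_notMem, hc]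
      intro h; exact hvQ _ h (by simp)
    · intro B hB
      rcases Finset.mem_insert.1 hB with rfl | hB
      · simp
      · exact hne B hB
    · intro B hB u hu
      rcases Finset.mem_insert.1 hB with rfl | hB
      · rw [Finset.mem_singleton] at hu; subst hu; omega
      · have := hlt B hB u hu; omega
    · intro u hu
      rcases Nat.lt_or_ge u m with h | h
      · obtain ⟨B, ⟨hB, huB⟩, hun⟩ := hex u h
        refine ⟨B, ⟨Finset.mem_insert_of_mem hB, huB⟩, ?_⟩
        rintro C ⟨hC, huC⟩
        rcases Finset.mem_insert.1 hC with rfl | hC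
        · rw [Finset.mem_singleton] at huC; subst huC; omega
        · exact hun C ⟨hC, huC⟩
      · have : u = v := Fin.ext (by omega)
        subst this
        refine ⟨{v}, ⟨Finset.mem_insert_self _ _, by simp⟩, ?_⟩
        rintro C ⟨hC, huC⟩
        rcases Finset.mem_insert.1 hC with rfl | hC
        · rfl
        · exact absurd huC (hvQ C hC)
    · intro B hB
      rcases Finset.mem_insert.1 hB with rfl | hB
      · intro x hx y hy
        rw [Finset.mem_singleton] at hx hy
        subst hx; subst hy; exact G.loopless.irrefl _
      · exact hind B hB
  · intro P hP
    exact Finset.insert_erase (Finset.mem_filter.1 hP).2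
  · intro Q hQ
    rw [mem_partSet] at hQ
    apply Finset.erase_insert
    intro h
    have := hQ.2.2.1 _ h v (by simp)
    omega

open Classical in
lemma card_single_zero {m : ℕ} (hm : m < n) :
    ((partSet G (m + 1) 0).filter fun P => {⟨m, hm⟩} ∈ P).card = 0 := by
  rw [Finset.card_eq_zero, Finset.filter_eq_empty_iff]
  intro P hP h
  rw [mem_partSet] at hP
  have := Finset.card_eq_zero.1 hP.1
  subst this
  simp at h

open Classical in
lemma card_nonsingle {m k : ℕ} (hm : m < n) :
    ((partSet G (m + 1) k).filter fun P => {⟨m, hm⟩} ∉ P).card =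
      ((partSet G m k).sigma fun Q => Q.filter fun B => ∀ u ∈ B, ¬ G.Adj u ⟨m, hm⟩).card := by
  set v : Fin n := ⟨m, hm⟩ with hv
  have hvm : (v : ℕ) = m := rfl
  symm
  refine Finset.card_bij (fun x _ => insert (insert v x.2) (x.1.erase x.2)) ?_ ?_ ?_
  · rintro ⟨Q, B⟩ hQB
    rw [Finset.mem_sigma, Finset.mem_filter, mem_partSet] at hQB
    obtain ⟨⟨hc, hne, hlt, hex, hind⟩, hB, hadj⟩ := hQB
    dsimp only at hc hne hlt hex hind hB hadj ⊢
    have hvQ : ∀ B ∈ Q, v ∉ B := fun B hB h => by have := hlt B hB v h; omega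
    rw [Finset.mem_filter, mem_partSet]
    have hBpos : 0 < Q.card := Finset.card_pos.2 ⟨B, hB⟩
    refine ⟨⟨?_, ?_, ?_, ?_, ?_⟩, ?_⟩
    · rw [Finset.card_insert_of_notMem, Finset.card_erase_of_mem hB]
      · omega
      · intro h; exact hvQ _ (Finset.mem_of_mem_erase h) (by simp)
    · intro C hC
      rcases Finset.mem_insert.1 hC with rfl | hC
      · simp
      · exact hne C (Finset.mem_of_mem_erase hC)
    · intro C hC u hu
      rcases Finset.mem_insert.1 hC with rfl | hC
      · rcases Finset.mem_insert.1 hu with rfl | hu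
        · omega
        · have := hlt B hB u hu; omega
      · have := hlt C (Finset.mem_of_mem_erase hC) u hu; omega
    · intro u hu
      rcases Nat.lt_or_ge u m with h | h
      · have huv : u ≠ v := by rintro rfl; omega
        obtain ⟨C, ⟨hC, huC⟩, hun⟩ := hex u h
        by_cases hCB : C = B
        · subst hCB
          refine ⟨insert v C, ⟨Finset.mem_insert_self _ _, Finset.mem_insert_of_mem huC⟩, ?_⟩
          rintro D ⟨hD, huD⟩
          rcases Finset.mem_insert.1 hD with rfl | hD
          · rfl
          · rw [Finset.mem_erase] at hD
            exact absurd (hun D ⟨hD.2, huD⟩) hD.1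
        · refine ⟨C, ⟨Finset.mem_insert_of_mem (Finset.mem_erase.2 ⟨hCB, hC⟩), huC⟩, ?_⟩
          rintro D ⟨hD, huD⟩
          rcases Finset.mem_insert.1 hD with rfl | hD
          · rcases Finset.mem_insert.1 huD with h' | h'
            · exact absurd h' huv
            · exact absurd (hun B ⟨hB, h'⟩).symm hCB
          · exact hun D ⟨Finset.mem_of_mem_erase hD, huD⟩
      · have : u = v := Fin.ext (by omega)
        subst this
        refine ⟨insert v B, ⟨Finset.mem_insert_self _ _, by simp⟩, ?_⟩
        rintro D ⟨hD, huD⟩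
        rcases Finset.mem_insert.1 hD with rfl | hD
        · rfl
        · exact absurd huD (hvQ D (Finset.mem_of_mem_erase hD))
    · intro C hC
      rcases Finset.mem_insert.1 hC with rfl | hC
      · intro x hx y hy
        rcases Finset.mem_insert.1 hx with rfl | hx
        · rcases Finset.mem_insert.1 hy with rfl | hy
          · exact G.loopless.irrefl _
          · exact fun h => hadj y hy h.symm
        · rcases Finset.mem_insert.1 hy with rfl | hy
          · exact hadj x hx
          · exact hind B hB x hx y hy
      · exact hind C (Finset.mem_of_mem_erase hC)
    · intro h
      rcases Finset.mem_insert.1 h with h | h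
      · obtain ⟨x, hx⟩ := hne B hB
        have : x ∈ ({v} : Finset (Fin n)) := by rw [h]; exact Finset.mem_insert_of_mem hx
        rw [Finset.mem_singleton] at this
        subst this
        exact hvQ B hB hx
      · exact hvQ _ (Finset.mem_of_mem_erase h) (by simp)
  · rintro ⟨Q, B⟩ hQB ⟨Q', B'⟩ hQB' he
    rw [Finset.mem_sigma, Finset.mem_filter, mem_partSet] at hQB hQB'
    obtain ⟨⟨-, -, hlt, -, -⟩, hB, -⟩ := hQB
    obtain ⟨⟨-, -, hlt', -, -⟩, hB', -⟩ := hQB'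
    dsimp only at *
    have hvQ : ∀ B ∈ Q, v ∉ B := fun B hB h => by have := hlt B hB v h; omega
    have hvQ' : ∀ B ∈ Q', v ∉ B := fun B hB h => by have := hlt' B hB v h; omega
    have h1 : insert v B ∈ insert (insert v B') (Q'.erase B') := by
      rw [← he]; exact Finset.mem_insert_self _ _
    have h2 : insert v B = insert v B' := by
      rcases Finset.mem_insert.1 h1 with h | h
      · exact h
      · exact absurd (Finset.mem_insert_self v B) (hvQ' _ (Finset.mem_of_mem_erase h))
    have h3 : B = B' := by
      rw [← Finset.erase_insert (hvQ B hB), h2, Finset.erase_insert (hvQ' B' hB')]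
    subst h3
    have h4 : Q.erase B = Q'.erase B := by
      rw [← Finset.erase_insert (a := insert v B) (s := Q.erase B), he, Finset.erase_insert]
      · intro h; exact hvQ' _ (Finset.mem_of_mem_erase h) (by simp)
      · intro h; exact hvQ _ (Finset.mem_of_mem_erase h) (by simp)
    have h5 : Q = Q' := by
      rw [← Finset.insert_erase hB, h4, Finset.insert_erase hB']
    subst h5
    rfl
  · intro P hP
    rw [Finset.mem_filter, mem_partSet] at hP
    obtain ⟨⟨hc, hne, hlt, hex, hind⟩, hvP⟩ := hP
    obtain ⟨A, ⟨hA, hvA⟩, hun⟩ := hex v (by omega)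
    have hlt' : ∀ B ∈ P, B ≠ A → ∀ u ∈ B, (u : ℕ) < m := by
      intro B hB hBA u hu
      have := hlt B hB u hu
      rcases Nat.lt_or_ge u m with h | h
      · exact h
      · have : u = v := Fin.ext (by omega)
        subst this
        exact absurd (hun B ⟨hB, hu⟩) hBA
    have hne' : (A.erase v).Nonempty := by
      rw [Finset.nonempty_iff_ne_empty]
      intro h
      apply hvP
      have : A = {v} := by rw [← Finset.insert_erase hvA, h]; rfl
      rw [← this]; exact hA
    have hnot : A.erase v ∉ P.erase A := by
      intro h
      rw [Finset.mem_erase] at h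
      obtain ⟨x, hx⟩ := hne'
      have hxA := Finset.mem_of_mem_erase hx
      exact h.1 ((hex x (hlt A hA x hxA)).unique ⟨h.2, hx⟩ ⟨hA, hxA⟩)
    refine ⟨⟨insert (A.erase v) (P.erase A), A.erase v⟩, ?_, ?_⟩
    · rw [Finset.mem_sigma, Finset.mem_filter, mem_partSet]
      have hpos : 0 < P.card := Finset.card_pos.2 ⟨A, hA⟩
      refine ⟨⟨?_, ?_, ?_, ?_, ?_⟩, Finset.mem_insert_self _ _, ?_⟩
      · dsimp only
        rw [Finset.card_insert_of_notMem hnot, Finset.card_erase_of_mem hA]; omega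
      · intro B hB
        rcases Finset.mem_insert.1 hB with rfl | hB
        · exact hne'
        · exact hne B (Finset.mem_of_mem_erase hB)
      · intro B hB u hu
        rcases Finset.mem_insert.1 hB with rfl | hB
        · rw [Finset.mem_erase] at hu
          have h1 := hlt A hA u hu.2
          have h2 : (u : ℕ) ≠ m := fun h => hu.1 (Fin.ext h)
          omega
        · rw [Finset.mem_erase] at hB
          exact hlt' B hB.2 hB.1 u hu
      · intro u hu
        have huv : u ≠ v := by rintro rfl; omega
        obtain ⟨C, ⟨hC, huC⟩, hun'⟩ := hex u (by omega)
        by_cases hCA : C = A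
        · subst hCA
          refine ⟨C.erase v, ⟨Finset.mem_insert_self _ _, Finset.mem_erase.2 ⟨huv, huC⟩⟩, ?_⟩
          rintro D ⟨hD, huD⟩
          rcases Finset.mem_insert.1 hD with rfl | hD
          · rfl
          · rw [Finset.mem_erase] at hD
            exact absurd (hun' D ⟨hD.2, huD⟩) hD.1
        · refine ⟨C, ⟨Finset.mem_insert_of_mem (Finset.mem_erase.2 ⟨hCA, hC⟩), huC⟩, ?_⟩
          rintro D ⟨hD, huD⟩
          rcases Finset.mem_insert.1 hD with rfl | hD
          · exact absurd (hun' A ⟨hA, Finset.mem_of_mem_erase huD⟩).symm hCA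
          · exact hun' D ⟨Finset.mem_of_mem_erase hD, huD⟩
      · intro B hB
        rcases Finset.mem_insert.1 hB with rfl | hB
        · intro x hx y hy
          exact hind A hA x (Finset.mem_of_mem_erase hx) y (Finset.mem_of_mem_erase hy)
        · exact hind B (Finset.mem_of_mem_erase hB)
      · intro u hu
        exact hind A hA u (Finset.mem_of_mem_erase hu) v hvA
    · dsimp only
      rw [Finset.erase_insert hnot, Finset.insert_erase hvA, Finset.insert_erase hA]

lemma gsi_succ (hG : IsPEO G) {m : ℕ} (hm : m < n) (k : ℕ) :
    (graphStirlingInduced G (m + 1) k : ℝ) =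
      stepD (backDeg G m) (fun k => (graphStirlingInduced G m k : ℝ)) k := by
  classical
  simp only [gsi_eq, stepD]
  rw [← Finset.card_filter_add_card_filter_not (s := partSet G (m + 1) k)
    (fun P => {⟨m, hm⟩} ∈ P), Nat.cast_add]
  congr 1
  · rcases k with _ | k
    · rw [card_single_zero]; simp
    · rw [card_single]; simp
  · rw [card_nonsingle, Finset.card_sigma, Nat.cast_sum]
    rw [Finset.sum_congr rfl (g := fun _ => (k : ℝ) - backDeg G m), Finset.sum_const, nsmul_eq_mul,
      mul_comm]
    intro Q hQ
    have := card_good G hG hm ((mem_partSet G).1 hQ)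
    rw [eq_sub_iff_add_eq]
    exact_mod_cast this

lemma gsi_zero (k : ℕ) : (graphStirlingInduced G 0 k : ℝ) = if k = 0 then 1 else 0 := by
  have key : ∀ P, IsPart G 0 k P ↔ P = ∅ ∧ k = 0 := by
    intro P
    constructor
    · rintro ⟨hc, hne, hlt, -⟩
      have : P = ∅ := by
        rw [Finset.eq_empty_iff_forall_notMem]
        intro B hB
        obtain ⟨x, hx⟩ := hne B hB
        exact absurd (hlt B hB x hx) (by omega)
      subst this
      exact ⟨rfl, by simpa using hc.symm⟩
    · rintro ⟨rfl, rfl⟩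
      simp [IsPart]
  rw [gsi_eq]
  split_ifs with h
  · have : partSet G 0 k = {∅} := by
      ext P; rw [mem_partSet, key]; simp [h]
    rw [this]; simp
  · have : partSet G 0 k = ∅ := by
      ext P; rw [mem_partSet, key]; simp [h]
    rw [this]; simp

lemma gsi_arrT (hG : IsPEO G) (m : ℕ) (hm : m ≤ n) (k : ℕ) :
    (graphStirlingInduced G m k : ℝ) = arrT (backDeg G) m k := by
  induction m generalizing k with
  | zero => rw [gsi_zero]; rfl
  | succ m ih =>
    rw [gsi_succ G hG (by omega)]
    show _ = stepD _ _ _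
    congr 1
    funext k
    exact ih (by omega) k

end Comb

theorem stmt5 {n : ℕ} (G : SimpleGraph (Fin n)) (hG : IsPEO G) :
    ∀ (p : ℕ) (r c : Fin p → Fin (n + 1)), StrictMono r → StrictMono c →
      0 ≤ (Matrix.of fun i j =>
            (graphStirlingInduced G (r i : ℕ) (c j : ℕ) : ℝ)).det := by
  intro p r c hr hc
  have h := arrT_tnn (backDeg G) (backDeg_rgrow G hG) p (fun i => (r i : ℕ)) (fun j => (c j : ℕ))
    hr hc (fun i => by have := (r i).2; omega)
  have e : (Matrix.of fun i j => (graphStirlingInduced G (r i : ℕ) (c j : ℕ) : ℝ)) =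
      Matrix.of fun i j => arrT (backDeg G) (r i : ℕ) (c j : ℕ) := by
    ext i j
    simp only [Matrix.of_apply]
    exact gsi_arrT G hG _ (by have := (r i).2; omega) _
  rw [e]
  exact h
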